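/- Let a > 1 and C ≥ 0, and let f : [0,∞) → ℝ be twice continuously differentiable with |f''(r) - (1/4)·f(r)| ≤ C·e^{(3/2-a)r} for all r ≥ 0. Then the function r ↦ e^{-r/2}·f(r) converges as r → ∞ to a finite limit ℓ, and as r → ∞ both |(e^{-r/2}f)'(r)| and |e^{-r/2}f(r) - ℓ| are O(e^{-(a-1)r}) if 1 < a < 2, O((r+1)·e^{-r}) if a = 2, and O(e^{-r}) if a > 2. -/

import Mathlib

open Filter Asymptotics Real Set

/-- If `|h'| ≤ B'` on `[0, ∞)`, then the increments of `h` are dominated by those of `B`. -/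
theorem abs_sub_le_sub_of_abs_deriv_le {h h' B B' : ℝ → ℝ}
    (hh : ∀ r ∈ Ici (0 : ℝ), HasDerivWithinAt h (h' r) (Ici 0) r)
    (hB : ∀ r, HasDerivAt B (B' r) r)
    (hle : ∀ r, 0 ≤ r → |h' r| ≤ B' r) {r s : ℝ} (hr : 0 ≤ r) (hrs : r ≤ s) :
    |h s - h r| ≤ B s - B r := by
  have hB' : ∀ r ∈ Ici (0 : ℝ), HasDerivWithinAt B (B' r) (Ici 0) r :=
    fun r _ => (hB r).hasDerivWithinAt
  have hsub : MonotoneOn (fun r => B r - h r) (Ici 0) := by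
    refine monotoneOn_of_hasDerivWithinAt_nonneg (f' := fun r => B' r - h' r) (convex_Ici 0)
      (fun x hx => ((hB' x hx).sub (hh x hx)).continuousWithinAt)
      (fun x hx => ((hB' x (interior_subset hx)).sub (hh x (interior_subset hx))).mono
        interior_subset) (fun x hx => ?_)
    linarith [(abs_le.1 (hle x (interior_subset hx))).2]
  have hadd : MonotoneOn (fun r => B r + h r) (Ici 0) := by
    refine monotoneOn_of_hasDerivWithinAt_nonneg (f' := fun r => B' r + h' r) (convex_Ici 0)
      (fun x hx => ((hB' x hx).add (hh x hx)).continuousWithinAt)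
      (fun x hx => ((hB' x (interior_subset hx)).add (hh x (interior_subset hx))).mono
        interior_subset) (fun x hx => ?_)
    linarith [(abs_le.1 (hle x (interior_subset hx))).1]
  have h₁ := hsub (mem_Ici.2 hr) (mem_Ici.2 (hr.trans hrs)) hrs
  have h₂ := hadd (mem_Ici.2 hr) (mem_Ici.2 (hr.trans hrs)) hrs
  simp only at h₁ h₂
  rw [abs_le]
  constructor <;> linarith

/-- If `|g'| ≤ -P'` on `[0, ∞)` with `P ≥ 0` tending to `0`, then `g` converges at rate `P`. -/
theorem exists_tendsto_of_abs_deriv_le {g g' P P' : ℝ → ℝ}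
    (hg : ∀ r ∈ Ici (0 : ℝ), HasDerivWithinAt g (g' r) (Ici 0) r)
    (hP : ∀ r, HasDerivAt P (-P' r) r) (hle : ∀ r, 0 ≤ r → |g' r| ≤ P' r)
    (hnonneg : ∀ r, 0 ≤ r → 0 ≤ P r) (hlim : Tendsto P atTop (nhds 0)) :
    ∃ ℓ, Tendsto g atTop (nhds ℓ) ∧ ∀ r, 0 ≤ r → |g r - ℓ| ≤ P r := by
  have key : ∀ r s, 0 ≤ r → r ≤ s → |g s - g r| ≤ P r := fun r s hr hrs => by
    have := abs_sub_le_sub_of_abs_deriv_le (B := fun r => -P r) hg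
      (fun r => by simpa using (hP r).fun_neg) hle hr hrs
    linarith [hnonneg s (hr.trans hrs)]
  have hmax : (fun r : ℝ => max r 0) =ᶠ[atTop] id := by
    filter_upwards [eventually_ge_atTop 0] with r hr using max_eq_left hr
  have hcauchy : CauchySeq fun r => g (max r 0) := by
    refine cauchySeq_of_le_tendsto_0' (fun r => P (max r 0)) (fun r s hrs => ?_)
      (hlim.congr' (hmax.symm.fun_comp P))
    rw [dist_comm, Real.dist_eq]
    exact key _ _ (le_max_right _ _) (max_le_max_right _ hrs)
  obtain ⟨ℓ, hℓ⟩ := cauchySeq_tendsto_of_complete hcauchy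
  have hgℓ : Tendsto g atTop (nhds ℓ) := hℓ.congr' (hmax.fun_comp g)
  refine ⟨ℓ, hgℓ, fun r hr => ?_⟩
  rw [abs_sub_comm]
  refine le_of_tendsto ((hgℓ.sub_const (g r)).abs) ?_
  filter_upwards [eventually_ge_atTop r] with s hs using key r s hr hs

/-- A bound `|g'| ≤ K w` with `w` having a decaying antiderivative `-P` gives convergence of `g`,
with `g' = O(w)` and `g - ℓ = O(P)`. -/
theorem exists_tendsto_isBigO_of_abs_deriv_le {g g' w P : ℝ → ℝ} {K : ℝ} (hK : 0 ≤ K)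
    (hg : ∀ r ∈ Ici (0 : ℝ), HasDerivWithinAt g (g' r) (Ici 0) r)
    (hP : ∀ r, HasDerivAt P (-w r) r) (hle : ∀ r, 0 ≤ r → |g' r| ≤ K * w r)
    (hnonneg : ∀ r, 0 ≤ r → 0 ≤ P r) (hlim : Tendsto P atTop (nhds 0)) :
    ∃ ℓ, Tendsto g atTop (nhds ℓ) ∧ derivWithin g (Ici 0) =O[atTop] w ∧
      (fun r => g r - ℓ) =O[atTop] P := by
  obtain ⟨ℓ, hℓ, hbound⟩ := exists_tendsto_of_abs_deriv_le (P := fun r => K * P r)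
    (P' := fun r => K * w r) hg (fun r => by simpa using (hP r).const_mul K) hle
    (fun r hr => mul_nonneg hK (hnonneg r hr)) (by simpa using hlim.const_mul K)
  refine ⟨ℓ, hℓ, IsBigO.of_bound K ?_, IsBigO.of_bound K ?_⟩
  · filter_upwards [eventually_ge_atTop 0] with r hr
    rw [(hg r hr).derivWithin (uniqueDiffOn_Ici 0 r hr), Real.norm_eq_abs, Real.norm_eq_abs]
    exact (hle r hr).trans (mul_le_mul_of_nonneg_left (le_abs_self _) hK)
  · filter_upwards [eventually_ge_atTop 0] with r hr
    rw [Real.norm_eq_abs, Real.norm_eq_abs]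
    exact (hbound r hr).trans (mul_le_mul_of_nonneg_left (le_abs_self _) hK)

theorem hasDerivAt_exp_const_mul (c r : ℝ) :
    HasDerivAt (fun r => exp (c * r)) (c * exp (c * r)) r := by
  simpa [mul_comm] using ((hasDerivAt_id r).const_mul c).exp

theorem tendsto_exp_neg_mul_atTop {c : ℝ} (hc : 0 < c) :
    Tendsto (fun r => exp (-c * r)) atTop (nhds 0) :=
  tendsto_exp_atBot.comp (tendsto_id.const_mul_atTop_of_neg (neg_lt_zero.2 hc))

theorem stmt_12 (a C : ℝ) (ha : 1 < a) (hC : 0 ≤ C)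
    (f : ℝ → ℝ) (hf : ContDiffOn ℝ 2 f (Ici 0))
    (hineq : ∀ r : ℝ, 0 ≤ r →
      |derivWithin (derivWithin f (Ici 0)) (Ici 0) r - (1/4) * f r|
        ≤ C * exp ((3/2 - a) * r)) :
    ∃ ℓ : ℝ, Tendsto (fun r => exp (-r/2) * f r) atTop (nhds ℓ) ∧
      (a < 2 →
        (derivWithin (fun r => exp (-r/2) * f r) (Ici 0) =O[atTop]
          fun r => exp (-(a - 1) * r)) ∧
        ((fun r => exp (-r/2) * f r - ℓ) =O[atTop] fun r => exp (-(a - 1) * r))) ∧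
      (a = 2 →
        (derivWithin (fun r => exp (-r/2) * f r) (Ici 0) =O[atTop]
          fun r => (r + 1) * exp (-r)) ∧
        ((fun r => exp (-r/2) * f r - ℓ) =O[atTop] fun r => (r + 1) * exp (-r))) ∧
      (2 < a →
        (derivWithin (fun r => exp (-r/2) * f r) (Ici 0) =O[atTop]
          fun r => exp (-r)) ∧
        ((fun r => exp (-r/2) * f r - ℓ) =O[atTop] fun r => exp (-r))) := by
  set g : ℝ → ℝ := fun r => exp (-r/2) * f r
  set f' := derivWithin f (Ici 0)
  set f'' := derivWithin f' (Ici 0)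
  have hf₁ : ∀ r ∈ Ici (0 : ℝ), HasDerivWithinAt f (f' r) (Ici 0) r := fun r hr =>
    (hf.differentiableOn (by norm_num) r hr).hasDerivWithinAt
  have hf₂ : ∀ r ∈ Ici (0 : ℝ), HasDerivWithinAt f' (f'' r) (Ici 0) r := fun r hr =>
    ((hf.derivWithin (uniqueDiffOn_Ici 0) (m := 1) (by norm_num)).differentiableOn
      (by norm_num) r hr).hasDerivWithinAt
  let h : ℝ → ℝ := fun r => exp (1/2 * r) * (f' r - 1/2 * f r)
  have hh : ∀ r ∈ Ici (0 : ℝ),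
      HasDerivWithinAt h (exp (1/2 * r) * (f'' r - 1/4 * f r)) (Ici 0) r := fun r hr => by
    refine ((hasDerivAt_exp_const_mul (1/2) r).hasDerivWithinAt.fun_mul
      ((hf₂ r hr).fun_sub ((hf₁ r hr).const_mul (1/2)))).congr_deriv ?_
    ring
  have hg : ∀ r ∈ Ici (0 : ℝ), HasDerivWithinAt g (exp (-r) * h r) (Ici 0) r := fun r hr => by
    have hexp : HasDerivAt (fun r : ℝ => exp (-r/2)) (-1/2 * exp (-r/2)) r := by
      convert hasDerivAt_exp_const_mul (-1/2) r using 3 <;> ring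
    refine (hexp.hasDerivWithinAt.fun_mul (hf₁ r hr)).congr_deriv ?_
    have : exp (-r) * exp (1/2 * r) = exp (-r/2) := by rw [← exp_add]; ring_nf
    simp only [h]
    rw [← mul_assoc, this]
    ring
  have hh' : ∀ r, 0 ≤ r → |exp (1/2 * r) * (f'' r - 1/4 * f r)| ≤ C * exp ((2 - a) * r) :=
    fun r hr => by
      have : exp ((2 - a) * r) = exp (1/2 * r) * exp ((3/2 - a) * r) := by
        rw [← exp_add]; ring_nf
      rw [abs_mul, abs_of_pos (exp_pos _), this, mul_left_comm]
      exact mul_le_mul_of_nonneg_left (hineq r hr) (exp_pos _).le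
  have hincr : ∀ {B : ℝ → ℝ}, (∀ r, HasDerivAt B (C * exp ((2 - a) * r)) r) →
      ∀ r, 0 ≤ r → |h r| ≤ |h 0| + (B r - B 0) := fun hB r hr => by
    have h₁ := abs_sub_le_sub_of_abs_deriv_le hh hB hh' le_rfl hr
    linarith [abs_sub_abs_le_abs_sub (h r) (h 0)]
  have hB_ne : a ≠ 2 → ∀ r, HasDerivAt (fun r => C / (2 - a) * exp ((2 - a) * r))
      (C * exp ((2 - a) * r)) r := fun hne r => by
    have : 2 - a ≠ 0 := sub_ne_zero.2 hne.symm
    refine ((hasDerivAt_exp_const_mul (2 - a) r).const_mul (C / (2 - a))).congr_deriv ?_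
    field_simp
  have hexp_lim : Tendsto (fun r : ℝ => exp (-r)) atTop (nhds 0) := tendsto_exp_neg_atTop_nhds_zero
  have hexp_deriv : ∀ r : ℝ, HasDerivAt (fun r => exp (-r)) (-exp (-r)) r := fun r => by
    simpa using hasDerivAt_exp_const_mul (-1) r
  have hg_le : ∀ {r b : ℝ}, |h r| ≤ b → |exp (-r) * h r| ≤ exp (-r) * b := fun hb => by
    rw [abs_mul, abs_of_pos (exp_pos _)]
    exact mul_le_mul_of_nonneg_left hb (exp_pos _).le
  rcases lt_trichotomy a 2 with hlt | heq | hgt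
  · have ha₁ : 0 < a - 1 := by linarith
    have ha₂ : 0 < 2 - a := by linarith
    have hK : 0 ≤ |h 0| + C / (2 - a) := by positivity
    obtain ⟨ℓ, hℓ, hO, hO'⟩ := exists_tendsto_isBigO_of_abs_deriv_le
      (w := fun r => exp (-(a - 1) * r)) (P := fun r => (a - 1)⁻¹ * exp (-(a - 1) * r)) hK hg
      (fun r => by
        refine ((hasDerivAt_exp_const_mul (-(a - 1)) r).const_mul (a - 1)⁻¹).congr_deriv ?_
        field_simp)
      (fun r hr => by
        have h₁ := hincr (hB_ne hlt.ne) r hr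
        have h₂ : 1 ≤ exp ((2 - a) * r) := one_le_exp (by positivity)
        have h₃ : 0 ≤ C / (2 - a) := by positivity
        have h₄ : |h r| ≤ (|h 0| + C / (2 - a)) * exp ((2 - a) * r) := by
          simp only [mul_zero, exp_zero] at h₁
          nlinarith [mul_le_mul_of_nonneg_left h₂ (abs_nonneg (h 0))]
        refine (hg_le h₄).trans_eq ?_
        rw [mul_left_comm, ← exp_add]
        ring_nf)
      (fun r _ => by positivity)
      (by simpa using (tendsto_exp_neg_mul_atTop ha₁).const_mul (a - 1)⁻¹)
    exact ⟨ℓ, hℓ, fun _ => ⟨hO, hO'.trans (isBigO_const_mul_self _ _ _)⟩,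
      fun h₂ => absurd h₂ hlt.ne, fun h₂ => absurd h₂ hlt.not_gt⟩
  · subst heq
    have hK : 0 ≤ |h 0| + C := by positivity
    obtain ⟨ℓ, hℓ, hO, hO'⟩ := exists_tendsto_isBigO_of_abs_deriv_le
      (w := fun r => (r + 1) * exp (-r)) (P := fun r => (r + 2) * exp (-r)) hK hg
      (fun r => by
        refine (((hasDerivAt_id' r).add_const 2).fun_mul (hexp_deriv r)).congr_deriv ?_
        ring)
      (fun r hr => by
        have h₁ := hincr (B := fun r => C * r)
          (fun r => by simpa using (hasDerivAt_id r).const_mul C) r hr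
        have h₂ : |h r| ≤ (|h 0| + C) * (r + 1) := by
          nlinarith [mul_nonneg (abs_nonneg (h 0)) hr]
        exact (hg_le h₂).trans_eq (by ring))
      (fun r hr => by positivity)
      (by
        have h₁ : Tendsto (fun r : ℝ => r * exp (-r)) atTop (nhds 0) := by
          simpa using tendsto_pow_mul_exp_neg_atTop_nhds_zero 1
        simpa [add_mul] using h₁.add (hexp_lim.const_mul 2))
    refine ⟨ℓ, hℓ, fun h₂ => absurd h₂ (lt_irrefl _), fun _ => ⟨hO, hO'.trans ?_⟩,
      fun h₂ => absurd h₂ (lt_irrefl _)⟩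
    refine IsBigO.of_bound 2 ?_
    filter_upwards [eventually_ge_atTop 0] with r hr
    rw [Real.norm_of_nonneg (by positivity), Real.norm_of_nonneg (by positivity), ← mul_assoc]
    exact mul_le_mul_of_nonneg_right (by linarith) (exp_pos _).le
  · have ha₂ : 0 < a - 2 := by linarith
    have hK : 0 ≤ |h 0| + C / (a - 2) := by positivity
    obtain ⟨ℓ, hℓ, hO, hO'⟩ := exists_tendsto_isBigO_of_abs_deriv_le
      (w := fun r => exp (-r)) (P := fun r => exp (-r)) hK hg hexp_deriv
      (fun r hr => by
        have h₁ := hincr (hB_ne hgt.ne') r hr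
        have h₂ : C / (2 - a) = -(C / (a - 2)) := by rw [← div_neg, neg_sub]
        have h₃ : 0 ≤ C / (a - 2) * exp ((2 - a) * r) := by positivity
        have h₄ : |h r| ≤ |h 0| + C / (a - 2) := by
          simp only [mul_zero, exp_zero, h₂] at h₁
          linarith
        exact (hg_le h₄).trans_eq (mul_comm _ _))
      (fun r _ => (exp_pos _).le) hexp_lim
    exact ⟨ℓ, hℓ, fun h₂ => absurd h₂ hgt.not_gt, fun h₂ => absurd h₂ hgt.ne',
      fun _ => ⟨hO, hO'⟩⟩
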